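/- Let d = p^n - 3 and assume p^n > 3. Let M be the number of quadruples (x₁, x₂, x₃, x₄) ∈ F⁴ with F = GF(p^n) satisfying x₁ - x₂ + x₃ - x₄ = 0 and x₁^d - x₂^d + x₃^d - x₄^d = 0. Then M = 1 + (p^n - 1)·(3p^n + λ₂ + 4T₁ - 4 - 2η(-1) - η(-3)(2 + η(-3))), where λ₂ := ∑_{x ∈ F} η((x²+1)(x²+4x+1)) and T₁ is the number of roots in F of x⁴ + 2x³ + x² + 2x + 1. -/

import Mathlib

section

open Finset

variable {F : Type*} [Field F]

lemma pow_card_sub_three [Fintype F] (hq : 3 < Fintype.card F) (x : F) :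
    x ^ (Fintype.card F - 3) = x⁻¹ ^ 2 := by
  rcases eq_or_ne x 0 with rfl | hx
  · rw [zero_pow (by omega)]; simp
  · have h1 : x ^ (Fintype.card F - 3) * x ^ 2 = 1 := by
      rw [← pow_add, show Fintype.card F - 3 + 2 = Fintype.card F - 1 by omega,
        FiniteField.pow_card_sub_one_eq_one x hx]
    field_simp
    exact h1

/-- The quartic cuts out the ratios `t = x / y` with `x⁻² + y⁻² = (x + y)⁻²`. -/
lemma quartic_eq_zero_iff (h2 : (2 : F) ≠ 0) (t : F) :
    t ^ 4 + 2 * t ^ 3 + t ^ 2 + 2 * t + 1 = 0 ↔ t ≠ 0 ∧ t⁻¹ ^ 2 + 1 = (t + 1)⁻¹ ^ 2 := by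
  rcases eq_or_ne t 0 with rfl | ht
  · simp
  rcases eq_or_ne (t + 1) 0 with h | h
  · obtain rfl : t = -1 := by linear_combination h
    norm_num
    exact h2
  simp only [ne_eq, ht, not_false_eq_true, true_and]
  field_simp
  constructor <;> intro h' <;> linear_combination h'

lemma add_one_ne_zero_of_quartic {t : F} (h : t ^ 4 + 2 * t ^ 3 + t ^ 2 + 2 * t + 1 = 0) :
    t + 1 ≠ 0 := by
  intro h1
  obtain rfl : t = -1 := by linear_combination h1
  norm_num at h

lemma nondegenerate_iff (h2 : (2 : F) ≠ 0) {x y w : F} (hw : x + y = w + 1) :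
    (((((x⁻¹ ^ 2 + y⁻¹ ^ 2 = w⁻¹ ^ 2 + 1 ∧ x ≠ 1) ∧ y ≠ 1) ∧ x ≠ 0) ∧ y ≠ 0) ∧ w ≠ 0) ↔
    (w ≠ 0 ∧ w + 1 ≠ 0 ∧ w ^ 2 + 1 ≠ 0 ∧ w ^ 2 + w + 1 ≠ 0) ∧
      x * y * (w ^ 2 + 1) = -(w + 1) ^ 2 * w := by
  obtain rfl : y = w + 1 - x := by linear_combination hw
  constructor
  · rintro ⟨⟨⟨⟨⟨h, hx1⟩, hy1⟩, hx⟩, hy⟩, hw0⟩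
    have hne := mul_ne_zero (sub_ne_zero.2 hx1) (sub_ne_zero.2 hy1)
    have hxy := mul_ne_zero hx hy
    have key : x * (w + 1 - x) * (w ^ 2 + 1) = -(w + 1) ^ 2 * w := by
      field_simp at h
      apply mul_left_cancel₀ hne
      linear_combination -h
    have hs : w + 1 ≠ 0 := by
      intro hs
      obtain rfl : w = -1 := by linear_combination hs
      exact mul_ne_zero hxy h2 (by linear_combination key)
    have hw1 : w ^ 2 + 1 ≠ 0 := by
      intro h1
      rw [h1] at key
      exact mul_ne_zero (pow_ne_zero 2 hs) hw0 (by linear_combination key)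
    refine ⟨⟨hw0, hs, hw1, fun h3 => hne ?_⟩, key⟩
    apply mul_left_cancel₀ hw0
    linear_combination (x * (w + 1 - x) + w) * h3 - key
  · rintro ⟨⟨hw0, hs, hw1, h3⟩, key⟩
    have hxy : x * (w + 1 - x) ≠ 0 := by
      intro h0
      rw [h0] at key
      exact mul_ne_zero (pow_ne_zero 2 hs) hw0 (by linear_combination key)
    have hne : (x - 1) * (w + 1 - x - 1) ≠ 0 := by
      intro h0
      refine mul_ne_zero (mul_ne_zero h2 hw0) h3 ?_
      linear_combination key - (w ^ 2 + 1) * h0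
    have hx := left_ne_zero_of_mul hxy
    have hy := right_ne_zero_of_mul hxy
    refine ⟨⟨⟨⟨⟨?_, sub_ne_zero.1 (left_ne_zero_of_mul hne)⟩,
      sub_ne_zero.1 (right_ne_zero_of_mul hne)⟩, hx⟩, hy⟩, hw0⟩
    field_simp
    linear_combination -((x - 1) * (w + 1 - x - 1)) * key

variable [Fintype F] [DecidableEq F]

lemma card_filter_ne_zero : ((univ.filter fun u : F => u ≠ 0).card : ℤ) = Fintype.card F - 1 := by
  rw [filter_ne' univ (0 : F), card_erase_of_mem (mem_univ _), card_univ,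
    Nat.cast_sub Fintype.card_pos]
  simp

/-- Solutions of the homogeneous system split by whether the last coordinate vanishes. -/
lemma card_quadruples_eq :
    ((univ.filter fun t : F × F × F × F => t.1 - t.2.1 + t.2.2.1 - t.2.2.2 = 0 ∧
      t.1⁻¹ ^ 2 - t.2.1⁻¹ ^ 2 + t.2.2.1⁻¹ ^ 2 - t.2.2.2⁻¹ ^ 2 = 0).card : ℤ) =
    (univ.filter fun s : F × F => s.1⁻¹ ^ 2 + s.2⁻¹ ^ 2 = (s.1 + s.2)⁻¹ ^ 2).card +
    (Fintype.card F - 1) *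
      (univ.filter fun s : F × F => s.1⁻¹ ^ 2 + s.2⁻¹ ^ 2 = (s.1 + s.2 - 1)⁻¹ ^ 2 + 1).card := by
  rw [← card_filter_ne_zero, ← Nat.cast_mul, ← card_product, ← Nat.cast_add,
    ← card_filter_add_card_filter_not (fun t : F × F × F × F => t.2.2.2 = 0)]
  congr 2
  · refine card_nbij' (fun t => (t.1, t.2.2.1)) (fun s => (s.1, s.1 + s.2, s.2, 0)) ?_ ?_ ?_ ?_
    · rintro ⟨a, b, c, d⟩ h
      simp only [coe_filter, mem_filter, mem_univ, true_and, Set.mem_ofPred_eq] at h ⊢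
      obtain ⟨⟨h1, h3⟩, rfl⟩ := h
      obtain rfl : b = a + c := by linear_combination -h1
      simp only [inv_zero] at h3
      linear_combination h3
    · rintro ⟨a, c⟩ h
      simp only [coe_filter, mem_filter, mem_univ, true_and, Set.mem_ofPred_eq, inv_zero] at h ⊢
      refine ⟨⟨by ring, by linear_combination h⟩, trivial⟩
    · rintro ⟨a, b, c, d⟩ h
      simp only [coe_filter, mem_filter, mem_univ, true_and, Set.mem_ofPred_eq] at h ⊢
      obtain ⟨⟨h1, h3⟩, rfl⟩ := h
      obtain rfl : b = a + c := by linear_combination -h1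
      rfl
    · rintro ⟨a, c⟩ h
      rfl
  · refine card_nbij' (fun t => (t.2.2.2, (t.1 / t.2.2.2, t.2.2.1 / t.2.2.2)))
      (fun s => (s.1 * s.2.1, s.1 * (s.2.1 + s.2.2 - 1), s.1 * s.2.2, s.1)) ?_ ?_ ?_ ?_
    · rintro ⟨a, b, c, d⟩ h
      simp only [coe_filter, mem_filter, mem_univ, true_and, Set.mem_ofPred_eq, coe_product,
        Set.mem_prod] at h ⊢
      obtain ⟨⟨h1, h3⟩, hd⟩ := h
      refine ⟨hd, ?_⟩
      have hb : a / d + c / d - 1 = b / d := by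
        field_simp
        linear_combination h1
      rw [hb]
      simp only [div_eq_mul_inv, mul_inv, inv_inv]
      have : (d * d⁻¹) ^ 2 = 1 := by rw [mul_inv_cancel₀ hd, one_pow]
      linear_combination d ^ 2 * h3 + this
    · rintro ⟨u, a, c⟩ h
      simp only [coe_filter, mem_filter, mem_univ, true_and, Set.mem_ofPred_eq, coe_product,
        Set.mem_prod] at h ⊢
      obtain ⟨hu, h⟩ := h
      refine ⟨⟨by ring, ?_⟩, hu⟩
      simp only [mul_inv]
      linear_combination u⁻¹ ^ 2 * h
    · rintro ⟨a, b, c, d⟩ h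
      simp only [coe_filter, mem_filter, mem_univ, true_and, Set.mem_ofPred_eq] at h ⊢
      obtain ⟨⟨h1, h3⟩, hd⟩ := h
      simp only [Prod.mk.injEq, and_true]
      refine ⟨by field_simp, ?_, by field_simp⟩
      field_simp
      linear_combination h1
    · rintro ⟨u, a, c⟩ h
      simp only [coe_filter, mem_univ, true_and, Set.mem_ofPred_eq, coe_product,
        Set.mem_prod] at h ⊢
      obtain ⟨hu, h⟩ := h
      simp only [Prod.mk.injEq, true_and]
      constructor <;> field_simp

variable (F) in
/-- The roots in `F` of `x⁴ + 2x³ + x² + 2x + 1`. -/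
def quarticRoots : Finset F :=
  univ.filter fun x : F => x ^ 4 + 2 * x ^ 3 + x ^ 2 + 2 * x + 1 = 0

lemma mem_quarticRoots {x : F} :
    x ∈ quarticRoots F ↔ x ^ 4 + 2 * x ^ 3 + x ^ 2 + 2 * x + 1 = 0 := by
  simp [quarticRoots]

lemma card_pairs_inv_sq_add (h2 : (2 : F) ≠ 0) :
    ((univ.filter fun s : F × F => s.1⁻¹ ^ 2 + s.2⁻¹ ^ 2 = (s.1 + s.2)⁻¹ ^ 2).card : ℤ) =
    1 + (Fintype.card F - 1) * (2 + ((quarticRoots F).card : ℤ)) := by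
  have hx : ((univ.filter fun s : F × F => s.1⁻¹ ^ 2 + s.2⁻¹ ^ 2 = (s.1 + s.2)⁻¹ ^ 2).filter
      fun s => s.2 = 0).card = (univ : Finset F).card := by
    refine card_nbij' (fun s => s.1) (fun x => (x, 0)) ?_ ?_ ?_ ?_
    · simp [Set.MapsTo]
    · simp [Set.MapsTo]
    · rintro ⟨a, b⟩ h
      simp at h ⊢
      exact h.2.symm
    · intro a _
      rfl
  have hy : (((univ.filter fun s : F × F => s.1⁻¹ ^ 2 + s.2⁻¹ ^ 2 = (s.1 + s.2)⁻¹ ^ 2).filter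
      fun s => ¬ s.2 = 0).filter fun s => s.1 = 0).card =
      (univ.filter fun u : F => u ≠ 0).card := by
    refine card_nbij' (fun s => s.2) (fun x => (0, x)) ?_ ?_ ?_ ?_
    · rintro ⟨a, b⟩ h
      simp at h ⊢
      exact h.1.2
    · simp [Set.MapsTo]
    · rintro ⟨a, b⟩ h
      simp at h ⊢
      exact h.2.symm
    · intro a _
      rfl
  have hz : (((univ.filter fun s : F × F => s.1⁻¹ ^ 2 + s.2⁻¹ ^ 2 = (s.1 + s.2)⁻¹ ^ 2).filter
      fun s => ¬ s.2 = 0).filter fun s => ¬ s.1 = 0).card =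
      ((univ.filter fun u : F => u ≠ 0) ×ˢ quarticRoots F).card := by
    refine card_nbij' (fun s => (s.2, s.1 / s.2)) (fun x => (x.1 * x.2, x.1)) ?_ ?_ ?_ ?_
    · rintro ⟨a, b⟩ h
      simp only [mem_coe, mem_quarticRoots, coe_filter, mem_filter, mem_univ, true_and, Set.mem_ofPred_eq, coe_product,
        Set.mem_prod] at h ⊢
      obtain ⟨⟨h, hb⟩, ha⟩ := h
      refine ⟨hb, (quartic_eq_zero_iff h2 _).2 ⟨div_ne_zero ha hb, ?_⟩⟩
      have e : a / b + 1 = (a + b) / b := by field_simp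
      rw [e]
      simp only [div_eq_mul_inv, mul_inv, inv_inv]
      have : (b * b⁻¹) ^ 2 = 1 := by rw [mul_inv_cancel₀ hb, one_pow]
      linear_combination b ^ 2 * h - this
    · rintro ⟨u, t⟩ h
      simp only [mem_coe, mem_quarticRoots, coe_filter, mem_filter, mem_univ, true_and, Set.mem_ofPred_eq, coe_product,
        Set.mem_prod] at h ⊢
      obtain ⟨hu, h⟩ := h
      obtain ⟨ht, h⟩ := (quartic_eq_zero_iff h2 _).1 h
      refine ⟨⟨?_, hu⟩, mul_ne_zero hu ht⟩
      rw [show u * t + u = u * (t + 1) by ring]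
      simp only [mul_inv]
      linear_combination u⁻¹ ^ 2 * h
    · rintro ⟨a, b⟩ h
      simp only [coe_filter, mem_filter, mem_univ, true_and, Set.mem_ofPred_eq] at h ⊢
      obtain ⟨⟨h, hb⟩, ha⟩ := h
      simp only [Prod.mk.injEq, and_true]
      field_simp
    · rintro ⟨u, t⟩ h
      simp only [mem_coe, mem_quarticRoots, coe_filter, mem_univ, true_and, Set.mem_ofPred_eq, coe_product,
        Set.mem_prod] at h ⊢
      obtain ⟨hu, h⟩ := h
      simp only [Prod.mk.injEq, true_and]
      field_simp
  rw [← card_filter_add_card_filter_not (fun s : F × F => s.2 = 0), hx,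
    ← card_filter_add_card_filter_not (s := filter (fun s : F × F => ¬ s.2 = 0) _)
      (fun s : F × F => s.1 = 0), hy, hz, card_product, card_univ]
  push_cast
  rw [card_filter_ne_zero]
  ring

lemma card_sq_eq {η : F → ℤ} (h2 : (2 : F) ≠ 0) (hη0 : η 0 = 0)
    (hη1 : ∀ x : F, x ≠ 0 → IsSquare x → η x = 1)
    (hη2 : ∀ x : F, ¬ IsSquare x → η x = -1) (a : F) :
    ((univ.filter fun x : F => x ^ 2 = a).card : ℤ) = 1 + η a := by
  have hF : ringChar F ≠ 2 := by
    intro h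
    have := ringChar.Nat.cast_ringChar (R := F)
    rw [h] at this
    exact h2 (by exact_mod_cast this)
  have hη : η a = quadraticChar F a := by
    rcases eq_or_ne a 0 with rfl | ha
    · rw [hη0, quadraticChar_zero]
    by_cases hs : IsSquare a
    · rw [hη1 a ha hs, (quadraticChar_one_iff_isSquare ha).2 hs]
    · rw [hη2 a hs, quadraticChar_neg_one_iff_not_isSquare.2 hs]
  rw [hη, add_comm, ← quadraticChar_card_sqrts hF a]
  congr 2
  ext x
  simp

lemma card_left_eq_one :
    ((univ.filter fun s : F × F => s.1⁻¹ ^ 2 + s.2⁻¹ ^ 2 = (s.1 + s.2 - 1)⁻¹ ^ 2 + 1).filter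
      fun s => s.1 = 1).card = Fintype.card F := by
  rw [← card_univ]
  refine card_nbij' (fun s => s.2) (fun y => (1, y)) ?_ ?_ ?_ ?_
  · simp [Set.MapsTo]
  · simp [Set.MapsTo, add_comm]
  · rintro ⟨a, b⟩ h
    simp at h ⊢
    exact h.2.symm
  · intro a _
    rfl

lemma card_right_eq_one :
    (((univ.filter fun s : F × F => s.1⁻¹ ^ 2 + s.2⁻¹ ^ 2 = (s.1 + s.2 - 1)⁻¹ ^ 2 + 1).filter
      fun s => s.1 ≠ 1).filter fun s => s.2 = 1).card = (univ.filter fun u : F => u ≠ 0).card := by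
  refine card_nbij' (fun s => s.1 - 1) (fun x => (x + 1, 1)) ?_ ?_ ?_ ?_
  · rintro ⟨a, b⟩ h
    simp at h ⊢
    exact sub_ne_zero.2 h.1.2
  · simp [Set.MapsTo]
  · rintro ⟨a, b⟩ h
    simp at h ⊢
    exact h.2.symm
  · intro a _
    simp

lemma card_left_eq_zero (h2 : (2 : F) ≠ 0) :
    ((((univ.filter fun s : F × F => s.1⁻¹ ^ 2 + s.2⁻¹ ^ 2 = (s.1 + s.2 - 1)⁻¹ ^ 2 + 1).filter
      fun s => s.1 ≠ 1).filter fun s => s.2 ≠ 1).filter fun s => s.1 = 0).card =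
      (quarticRoots F).card := by
  refine card_nbij' (fun s => s.2 - 1) (fun t => (0, t + 1)) ?_ ?_ ?_ ?_
  · rintro ⟨a, b⟩ h
    simp only [mem_coe, mem_quarticRoots, mem_filter, mem_univ, true_and] at h ⊢
    obtain ⟨⟨⟨h, ha⟩, hb⟩, rfl⟩ := h
    refine (quartic_eq_zero_iff h2 _).2 ⟨sub_ne_zero.2 hb, ?_⟩
    simp only [inv_zero, zero_add, sub_add_cancel] at h ⊢
    linear_combination -h
  · intro t h
    simp only [mem_coe, mem_quarticRoots, mem_filter, mem_univ, true_and] at h ⊢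
    obtain ⟨h0, h⟩ := (quartic_eq_zero_iff h2 _).1 h
    refine ⟨⟨⟨?_, zero_ne_one⟩, by simpa using h0⟩, trivial⟩
    simp only [inv_zero, zero_add, add_sub_cancel_right]
    linear_combination -h
  · rintro ⟨a, b⟩ h
    simp at h ⊢
    exact h.2.symm
  · intro t _
    simp

lemma card_right_eq_zero (h2 : (2 : F) ≠ 0) :
    (((((univ.filter fun s : F × F => s.1⁻¹ ^ 2 + s.2⁻¹ ^ 2 = (s.1 + s.2 - 1)⁻¹ ^ 2 + 1).filter
      fun s => s.1 ≠ 1).filter fun s => s.2 ≠ 1).filter fun s => s.1 ≠ 0).filter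
      fun s => s.2 = 0).card = (quarticRoots F).card := by
  refine card_nbij' (fun s => s.1 - 1) (fun t => (t + 1, 0)) ?_ ?_ ?_ ?_
  · rintro ⟨a, b⟩ h
    simp only [mem_coe, mem_quarticRoots, mem_filter, mem_univ, true_and] at h ⊢
    obtain ⟨⟨⟨⟨h, ha⟩, hb⟩, ha0⟩, rfl⟩ := h
    refine (quartic_eq_zero_iff h2 _).2 ⟨sub_ne_zero.2 ha, ?_⟩
    simp only [inv_zero, add_zero, sub_add_cancel] at h ⊢
    linear_combination -h
  · intro t h
    simp only [mem_coe, mem_quarticRoots, mem_filter, mem_univ, true_and] at h ⊢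
    have h1 := add_one_ne_zero_of_quartic h
    obtain ⟨h0, h⟩ := (quartic_eq_zero_iff h2 _).1 h
    refine ⟨⟨⟨⟨?_, by simpa using h0⟩, zero_ne_one⟩, h1⟩, trivial⟩
    simp only [inv_zero, add_zero, add_sub_cancel_right]
    linear_combination -h
  · rintro ⟨a, b⟩ h
    simp at h ⊢
    exact h.2.symm
  · intro t _
    simp

lemma card_add_eq_one (h2 : (2 : F) ≠ 0) :
    ((((((univ.filter fun s : F × F => s.1⁻¹ ^ 2 + s.2⁻¹ ^ 2 = (s.1 + s.2 - 1)⁻¹ ^ 2 + 1).filter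
      fun s => s.1 ≠ 1).filter fun s => s.2 ≠ 1).filter fun s => s.1 ≠ 0).filter
      fun s => s.2 ≠ 0).filter fun s => s.1 + s.2 - 1 = 0).card = (quarticRoots F).card := by
  refine card_nbij' (fun s => s.1 / s.2) (fun t => (t / (t + 1), 1 / (t + 1))) ?_ ?_ ?_ ?_
  · rintro ⟨a, b⟩ h
    simp only [mem_coe, mem_quarticRoots, mem_filter, mem_univ, true_and] at h ⊢
    obtain ⟨⟨⟨⟨⟨h, ha⟩, hb⟩, ha0⟩, hb0⟩, hab⟩ := h
    obtain rfl : a = 1 - b := by linear_combination hab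
    refine (quartic_eq_zero_iff h2 _).2 ⟨div_ne_zero ha0 hb0, ?_⟩
    have e : (1 - b) / b + 1 = 1 / b := by field_simp; ring
    rw [e]
    rw [hab, inv_zero] at h
    simp only [div_eq_mul_inv, mul_inv, inv_inv, one_mul]
    have : (b * b⁻¹) ^ 2 = 1 := by rw [mul_inv_cancel₀ hb0, one_pow]
    linear_combination b ^ 2 * h - this
  · intro t h
    simp only [mem_coe, mem_quarticRoots, mem_filter, mem_univ, true_and] at h ⊢
    have h1 := add_one_ne_zero_of_quartic h
    obtain ⟨h0, h⟩ := (quartic_eq_zero_iff h2 _).1 h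
    have e : t / (t + 1) + 1 / (t + 1) - 1 = 0 := by field_simp; ring
    refine ⟨⟨⟨⟨⟨?_, ?_⟩, ?_⟩, div_ne_zero h0 h1⟩, div_ne_zero one_ne_zero h1⟩, e⟩
    · rw [e]
      field_simp at h ⊢
      linear_combination h
    · rw [Ne, div_eq_one_iff_eq h1]
      simp
    · rw [Ne, div_eq_one_iff_eq h1]
      simpa using h0
  · rintro ⟨a, b⟩ h
    simp only [mem_coe, mem_filter, mem_univ, true_and] at h ⊢
    obtain ⟨⟨⟨⟨⟨h, ha⟩, hb⟩, ha0⟩, hb0⟩, hab⟩ := h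
    obtain rfl : a = 1 - b := by linear_combination hab
    have e : (1 - b) / b + 1 = 1 / b := by field_simp; ring
    rw [e]
    simp only [Prod.mk.injEq]
    constructor <;> field_simp
  · intro t h
    simp only [mem_coe, mem_quarticRoots] at h
    have h1 := add_one_ne_zero_of_quartic h
    field_simp

/-- The solutions with no vanishing term and no trivial cancellation are parametrised by points
`(w, r)` of `r² = (w² + 1)(w² + 4w + 1)`, with `w = x + y - 1` and
`r = (x - y)(w² + 1) / (w + 1)`. -/
lemma card_nondegenerate (h2 : (2 : F) ≠ 0) :
    ((((((univ.filter fun s : F × F => s.1⁻¹ ^ 2 + s.2⁻¹ ^ 2 = (s.1 + s.2 - 1)⁻¹ ^ 2 + 1).filter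
      fun s => s.1 ≠ 1).filter fun s => s.2 ≠ 1).filter fun s => s.1 ≠ 0).filter
      fun s => s.2 ≠ 0).filter fun s => s.1 + s.2 - 1 ≠ 0).card =
    ∑ w ∈ univ.filter (fun w : F => w ≠ 0 ∧ w + 1 ≠ 0 ∧ w ^ 2 + 1 ≠ 0 ∧ w ^ 2 + w + 1 ≠ 0),
      (univ.filter fun r : F => r ^ 2 = (w ^ 2 + 1) * (w ^ 2 + 4 * w + 1)).card := by
  rw [← card_sigma]
  refine card_nbij' (fun s => ⟨s.1 + s.2 - 1,
      (s.1 - s.2) * ((s.1 + s.2 - 1) ^ 2 + 1) / (s.1 + s.2)⟩)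
    (fun t => ((t.1 + 1) * (1 + t.2 / (t.1 ^ 2 + 1)) / 2,
      (t.1 + 1) * (1 - t.2 / (t.1 ^ 2 + 1)) / 2)) ?_ ?_ ?_ ?_
  · rintro ⟨x, y⟩ h
    obtain ⟨w, hw⟩ : ∃ w, w = x + y - 1 := ⟨_, rfl⟩
    simp only [mem_coe, mem_filter, mem_univ, true_and, mem_sigma, ← hw] at h ⊢
    have hw' : x + y = w + 1 := by linear_combination -hw
    obtain ⟨hgood, key⟩ := (nondegenerate_iff h2 hw').1 h
    refine ⟨hgood, ?_⟩
    obtain ⟨hw0, hs, hw1, h3⟩ := hgood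
    rw [hw']
    obtain rfl : y = w + 1 - x := by linear_combination hw'
    field_simp
    linear_combination -4 * key
  · rintro ⟨w, r⟩ h
    simp only [mem_coe, mem_filter, mem_univ, true_and, mem_sigma] at h ⊢
    obtain ⟨hgood, h⟩ := h
    obtain ⟨hw0, hs, hw1, h3⟩ := id hgood
    have e : (w + 1) * (1 + r / (w ^ 2 + 1)) / 2 + (w + 1) * (1 - r / (w ^ 2 + 1)) / 2 =
        w + 1 := by
      field_simp
      ring
    rw [e, add_sub_cancel_right]
    refine (nondegenerate_iff h2 e).2 ⟨hgood, ?_⟩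
    field_simp
    linear_combination -h
  · rintro ⟨x, y⟩ h
    obtain ⟨w, hw⟩ : ∃ w, w = x + y - 1 := ⟨_, rfl⟩
    simp only [mem_coe, mem_filter, mem_univ, true_and, ← hw] at h ⊢
    have hw' : x + y = w + 1 := by linear_combination -hw
    obtain ⟨⟨hw0, hs, hw1, h3⟩, key⟩ := (nondegenerate_iff h2 hw').1 h
    rw [hw']
    obtain rfl : y = w + 1 - x := by linear_combination hw'
    simp only [Prod.mk.injEq]
    constructor
    · field_simp
      ring
    · field_simp
      ring
  · rintro ⟨w, r⟩ h
    simp only [mem_coe, mem_filter, mem_univ, true_and, mem_sigma] at h ⊢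
    obtain ⟨⟨hw0, hs, hw1, h3⟩, h⟩ := h
    have e : (w + 1) * (1 + r / (w ^ 2 + 1)) / 2 + (w + 1) * (1 - r / (w ^ 2 + 1)) / 2 =
        w + 1 := by
      field_simp
      ring
    simp only [e, add_sub_cancel_right, Sigma.mk.injEq, heq_eq_eq, true_and]
    field_simp
    ring

lemma sum_nondegenerate {η : F → ℤ} (h2 : (2 : F) ≠ 0) (hη0 : η 0 = 0)
    (hη1 : ∀ x : F, x ≠ 0 → IsSquare x → η x = 1)
    (hη2 : ∀ x : F, ¬ IsSquare x → η x = -1) :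
    ∑ w ∈ univ.filter (fun w : F => w ≠ 0 ∧ w + 1 ≠ 0 ∧ w ^ 2 + 1 ≠ 0 ∧ w ^ 2 + w + 1 ≠ 0),
      (1 + η ((w ^ 2 + 1) * (w ^ 2 + 4 * w + 1))) =
    Fintype.card F + ∑ w, η ((w ^ 2 + 1) * (w ^ 2 + 4 * w + 1)) - 5 - 2 * η (-1)
      - η (-3) * (2 + η (-3)) := by
  have hmul : ∀ c a : F, c ≠ 0 → η (a * c ^ 2) = η a := by
    intro c a hc
    rcases eq_or_ne a 0 with rfl | ha
    · simp
    have hiff : IsSquare (a * c ^ 2) ↔ IsSquare a := by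
      constructor
      · rintro ⟨b, hb⟩
        exact ⟨b / c, by field_simp; linear_combination hb⟩
      · rintro ⟨b, rfl⟩
        exact ⟨b * c, by ring⟩
    by_cases hs : IsSquare a
    · rw [hη1 a ha hs, hη1 _ (mul_ne_zero ha (pow_ne_zero 2 hc)) (hiff.2 hs)]
    · rw [hη2 a hs, hη2 _ (mt hiff.1 hs)]
  have hone : η 1 = 1 := hη1 1 one_ne_zero ⟨1, by ring⟩
  have hsplit : ∀ w : F, (if w ≠ 0 ∧ w + 1 ≠ 0 ∧ w ^ 2 + 1 ≠ 0 ∧ w ^ 2 + w + 1 ≠ 0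
      then 1 + η ((w ^ 2 + 1) * (w ^ 2 + 4 * w + 1)) else 0) =
      1 + η ((w ^ 2 + 1) * (w ^ 2 + 4 * w + 1)) - (if w = 0 then 2 else 0)
      - (if w = -1 then 1 + η (-1) else 0) - (if w ^ 2 = -1 then 1 else 0)
      - (if w ^ 2 + w + 1 = 0 then 1 + η (-3) else 0) := by
    intro w
    have hsq : w ^ 2 = -1 ↔ w ^ 2 + 1 = 0 := eq_neg_iff_add_eq_zero
    have hn : w = -1 ↔ w + 1 = 0 := eq_neg_iff_add_eq_zero
    simp only [hsq, hn]
    by_cases h0 : w = 0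
    · subst h0
      simp [hone]
    by_cases h1 : w + 1 = 0
    · obtain rfl : w = -1 := by linear_combination h1
      have e : (((-1 : F)) ^ 2 + 1) * ((-1) ^ 2 + 4 * (-1) + 1) = -1 * 2 ^ 2 := by ring
      have e2 : (1 : F) + 1 ≠ 0 := by rwa [one_add_one_eq_two]
      rw [e, hmul 2 _ h2]
      simp [e2]
    by_cases h3 : w ^ 2 + 1 = 0
    · have e2 : w ^ 2 + w + 1 ≠ 0 := by
        intro h
        exact h0 (by linear_combination h - h3)
      simp [h0, h1, h3, e2, hη0]
    by_cases h4 : w ^ 2 + w + 1 = 0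
    · have e : (w ^ 2 + 1) * (w ^ 2 + 4 * w + 1) = -3 * w ^ 2 := by
        linear_combination (w ^ 2 + 4 * w + 1 - w) * h4
      rw [e, hmul w _ h0]
      simp [h0, h1, h3, h4]
    simp [h0, h1, h3, h4]
  have hcube : ((univ.filter fun w : F => w ^ 2 + w + 1 = 0).card : ℤ) = 1 + η (-3) := by
    rw [← card_sq_eq h2 hη0 hη1 hη2]
    congr 1
    refine card_nbij' (fun w => 2 * w + 1) (fun r => (r - 1) / 2) ?_ ?_ ?_ ?_
    · intro w h
      simp only [mem_coe, mem_filter, mem_univ, true_and] at h ⊢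
      linear_combination 4 * h
    · intro r h
      simp only [mem_coe, mem_filter, mem_univ, true_and] at h ⊢
      field_simp
      linear_combination h
    · intro w _
      field_simp
      ring
    · intro r _
      field_simp
      ring
  have hneg := card_sq_eq h2 hη0 hη1 hη2 (-1)
  rw [sum_filter, sum_congr rfl fun w _ => hsplit w]
  simp only [sum_sub_distrib, sum_add_distrib, sum_ite_eq', mem_univ, if_true]
  rw [← sum_filter, ← sum_filter, sum_const, sum_const, sum_const]
  simp only [nsmul_eq_mul, hneg, hcube, card_univ]
  ring

lemma card_normalized {η : F → ℤ} (h2 : (2 : F) ≠ 0) (hη0 : η 0 = 0)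
    (hη1 : ∀ x : F, x ≠ 0 → IsSquare x → η x = 1)
    (hη2 : ∀ x : F, ¬ IsSquare x → η x = -1) :
    ((univ.filter fun s : F × F =>
      s.1⁻¹ ^ 2 + s.2⁻¹ ^ 2 = (s.1 + s.2 - 1)⁻¹ ^ 2 + 1).card : ℤ) =
    3 * Fintype.card F + ∑ w, η ((w ^ 2 + 1) * (w ^ 2 + 4 * w + 1))
      + 3 * (quarticRoots F).card - 6 - 2 * η (-1) - η (-3) * (2 + η (-3)) := by
  have hN := congrArg (Nat.cast : ℕ → ℤ) (card_nondegenerate h2)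
  rw [Nat.cast_sum, sum_congr rfl fun w _ => card_sq_eq h2 hη0 hη1 hη2 _,
    sum_nondegenerate h2 hη0 hη1 hη2] at hN
  rw [← card_filter_add_card_filter_not (fun s : F × F => s.1 = 1), card_left_eq_one,
    ← card_filter_add_card_filter_not (s := filter (fun s : F × F => ¬ s.1 = 1) _)
      (fun s : F × F => s.2 = 1), card_right_eq_one,
    ← card_filter_add_card_filter_not (s := filter (fun s : F × F => ¬ s.2 = 1) _)
      (fun s : F × F => s.1 = 0), card_left_eq_zero h2,
    ← card_filter_add_card_filter_not (s := filter (fun s : F × F => ¬ s.1 = 0) _)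
      (fun s : F × F => s.2 = 0), card_right_eq_zero h2,
    ← card_filter_add_card_filter_not (s := filter (fun s : F × F => ¬ s.2 = 0) _)
      (fun s : F × F => s.1 + s.2 - 1 = 0), card_add_eq_one h2]
  push_cast
  rw [card_filter_ne_zero, hN]
  ring

end


/-- With `d = p^n - 3` and `p^n > 3`, the number `M` of quadruples
`(x₁,x₂,x₃,x₄) ∈ F⁴` with `x₁ - x₂ + x₃ - x₄ = 0` and
`x₁^d - x₂^d + x₃^d - x₄^d = 0` equals
`1 + (p^n - 1)(3p^n + λ₂ + 4T₁ - 4 - 2η(-1) - η(-3)(2 + η(-3)))`, where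
`λ₂ = ∑_{x ∈ F} η((x²+1)(x²+4x+1))` and `T₁` is the number of roots in `F`
of `x⁴ + 2x³ + x² + 2x + 1`. -/
theorem stmt_9 (p n : ℕ) (hp : p.Prime) (hp2 : p ≠ 2) (hn : 0 < n)
    (F : Type*) [Field F] [Fintype F] [DecidableEq F]
    (hF : Fintype.card F = p ^ n)
    (hq : 3 < p ^ n)
    (η : F → ℤ)
    (hη0 : η 0 = 0)
    (hη1 : ∀ x : F, x ≠ 0 → IsSquare x → η x = 1)
    (hη2 : ∀ x : F, ¬ IsSquare x → η x = -1) :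
    ((Finset.univ.filter
      (fun t : F × F × F × F => t.1 - t.2.1 + t.2.2.1 - t.2.2.2 = 0 ∧
        t.1 ^ (p ^ n - 3) - t.2.1 ^ (p ^ n - 3) + t.2.2.1 ^ (p ^ n - 3)
          - t.2.2.2 ^ (p ^ n - 3) = 0)).card : ℤ) =
      1 + ((p : ℤ) ^ n - 1) * (3 * (p : ℤ) ^ n
        + (∑ x : F, η ((x ^ 2 + 1) * (x ^ 2 + 4 * x + 1)))
        + 4 * ((Finset.univ.filter
            (fun x : F => x ^ 4 + 2 * x ^ 3 + x ^ 2 + 2 * x + 1 = 0)).card : ℤ)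
        - 4 - 2 * η (-1) - η (-3) * (2 + η (-3))) := by
  have h2 : (2 : F) ≠ 0 := by
    intro h
    have hodd : (p ^ n) % 2 = 1 := Nat.odd_iff.1 ((hp.odd_of_ne_two hp2).pow)
    have h1 : ((p ^ n : ℕ) : F) = 0 := by rw [← hF, Nat.cast_card_eq_zero]
    rw [← Nat.div_add_mod (p ^ n) 2, hodd] at h1
    push_cast at h1
    rw [h] at h1
    simp at h1
  have hq' : 3 < Fintype.card F := hF ▸ hq
  have hqz : ((p : ℤ) ^ n) = Fintype.card F := by rw [hF]; push_cast; rfl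
  rw [← hF, hqz]
  simp only [pow_card_sub_three hq']
  rw [card_quadruples_eq, card_pairs_inv_sq_add h2, card_normalized h2 hη0 hη1 hη2]
  simp only [quarticRoots]
  ring
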